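/- Let q(x,y) = ax² + bxy + cy² be a primitive integral binary quadratic form with a ≠ 0 and discriminant d = b² − 4ac > 0 not a perfect square, with even Gram matrix G, minimal Pell solution (U,V) and automorph u as above. Let C be one of the two connected components of the light cone {v ∈ ℝ² : vᵀ G v > 0}. Then a matrix M ∈ GL₂(ℤ) with det M = 1 and Mᵀ G M = G maps C onto itself if and only if M = u^k for some k ∈ ℤ (in particular u maps C onto itself, while −u^k does not). -/

import Mathlib

open Matrix

lemma aut_param (a b c : ℤ) (ha : a ≠ 0) (hprim : Int.gcd a (Int.gcd b c) = 1)
    (d : ℤ) (hd : d = b ^ 2 - 4 * a * c)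
    (M : Matrix (Fin 2) (Fin 2) ℤ) (hdet : M.det = 1)
    (hM : Mᵀ * !![2 * a, b; b, 2 * c] * M = !![2 * a, b; b, 2 * c]) :
    ∃ x y : ℤ, x ^ 2 - d * y ^ 2 = 4 ∧ M 0 0 + M 1 1 = x ∧ 2 * M 0 0 = x - b * y ∧
      M 0 1 = -c * y ∧ M 1 0 = a * y ∧ 2 * M 1 1 = x + b * y := by
  have h1 : !![2 * a, b; b, 2 * c] * M = M.adjugateᵀ * !![2 * a, b; b, 2 * c] := by
    have h2 : M.adjugateᵀ * Mᵀ = 1 := by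
      rw [← Matrix.transpose_mul, Matrix.mul_adjugate, hdet, one_smul, Matrix.transpose_one]
    calc !![2 * a, b; b, 2 * c] * M = (M.adjugateᵀ * Mᵀ) * !![2 * a, b; b, 2 * c] * M := by
          rw [h2, one_mul]
      _ = M.adjugateᵀ * (Mᵀ * !![2 * a, b; b, 2 * c] * M) := by simp only [Matrix.mul_assoc]
      _ = _ := by rw [hM]
  rw [Matrix.det_fin_two] at hdet
  have e00 := congrFun (congrFun h1 0) 0
  have e01 := congrFun (congrFun h1 0) 1
  have e11 := congrFun (congrFun h1 1) 1
  simp [Matrix.mul_apply, Fin.sum_univ_two, Matrix.adjugate_fin_two] at e00 e01 e11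
  generalize M 0 0 = p at *
  generalize M 0 1 = q at *
  generalize M 1 0 = r at *
  generalize M 1 1 = s at *
  have f1 : a * (s - p) = b * r := by linarith
  have f2 : a * q = -c * r := by linarith
  have hdvd : a ∣ r := by
    have hb : a ∣ r * b := ⟨s - p, by linarith⟩
    have hc : a ∣ r * c := ⟨-q, by linarith⟩
    have hg : a ∣ r * (Int.gcd b c : ℤ) := by
      rw [Int.gcd_eq_gcd_ab b c, mul_add, ← mul_assoc, ← mul_assoc]
      exact dvd_add (hb.mul_right _) (hc.mul_right _)
    exact (Int.isCoprime_iff_gcd_eq_one.mpr hprim).dvd_of_dvd_mul_right hg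
  obtain ⟨y, rfl⟩ := hdvd
  have g1 : s - p = b * y := mul_left_cancel₀ ha (by linarith)
  have g2 : q = -c * y := mul_left_cancel₀ ha (by linarith)
  refine ⟨p + s, y, ?_, rfl, by linarith, g2, rfl, by linarith⟩
  subst g2
  have : s = p + b * y := by linarith
  subst this
  subst hd
  linear_combination 4 * hdet

/-- proper automorphs of positive trace -/
def autGrp (a b c d : ℤ) (ha : a ≠ 0) (hprim : Int.gcd a (Int.gcd b c) = 1)
    (hd : d = b ^ 2 - 4 * a * c) (hdpos : 0 < d) : Subgroup (GL (Fin 2) ℤ) where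
  carrier := {N | (N : Matrix (Fin 2) (Fin 2) ℤ).det = 1 ∧
    (N : Matrix (Fin 2) (Fin 2) ℤ)ᵀ * !![2 * a, b; b, 2 * c] * (N : Matrix (Fin 2) (Fin 2) ℤ)
      = !![2 * a, b; b, 2 * c] ∧
    0 < (N : Matrix (Fin 2) (Fin 2) ℤ) 0 0 + (N : Matrix (Fin 2) (Fin 2) ℤ) 1 1}
  one_mem' := by simp
  mul_mem' := by
    rintro N N' ⟨h1, h2, h3⟩ ⟨h1', h2', h3'⟩
    refine ⟨by simp [h1, h1'], ?_, ?_⟩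
    · rw [Units.val_mul, Matrix.transpose_mul]
      calc _ = (N' : Matrix (Fin 2) (Fin 2) ℤ)ᵀ * ((N : Matrix (Fin 2) (Fin 2) ℤ)ᵀ *
            !![2 * a, b; b, 2 * c] * (N : Matrix (Fin 2) (Fin 2) ℤ)) * N' := by
            simp only [Matrix.mul_assoc]
        _ = _ := by rw [h2, h2']
    · obtain ⟨x, y, hxy, e0, e1, e2, e3, e4⟩ := aut_param a b c ha hprim d hd _ h1 h2
      obtain ⟨x', y', hxy', e0', e1', e2', e3', e4'⟩ := aut_param a b c ha hprim d hd _ h1' h2'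
      rw [e0] at h3
      rw [e0'] at h3'
      simp only [Units.val_mul, Matrix.mul_apply, Fin.sum_univ_two]
      generalize (N : Matrix (Fin 2) (Fin 2) ℤ) 0 0 = p at *
      generalize (N : Matrix (Fin 2) (Fin 2) ℤ) 1 1 = s at *
      generalize (N' : Matrix (Fin 2) (Fin 2) ℤ) 0 0 = p' at *
      generalize (N' : Matrix (Fin 2) (Fin 2) ℤ) 1 1 = s' at *
      rw [e2, e3, e2', e3']
      have key : 0 < x * x' + d * y * y' := by
        have : |d * y * y'| < |x * x'| := by
          apply sq_lt_sq.mp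
          have hx : x ^ 2 = 4 + d * y ^ 2 := by linarith
          have hx' : x' ^ 2 = 4 + d * y' ^ 2 := by linarith
          rw [mul_pow x x', hx, hx']
          nlinarith [mul_nonneg hdpos.le (sq_nonneg y), mul_nonneg hdpos.le (sq_nonneg y')]
        rw [abs_of_pos (mul_pos h3 h3')] at this
        linarith [(abs_lt.mp this).1]
      subst hd
      have : 4 * (p * p' + -c * y * (a * y') + (a * y * (-c * y') + s * s')) =
        2 * (x * x' + (b ^ 2 - 4 * a * c) * y * y') := by
        linear_combination (2 * p') * e1 + (x - b * y) * e1' + (2 * s') * e4 + (x + b * y) * e4'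
      linarith
  inv_mem' := by
    rintro N ⟨h1, h2, h3⟩
    have hinv : ((N⁻¹ : GL (Fin 2) ℤ) : Matrix (Fin 2) (Fin 2) ℤ) =
        (N : Matrix (Fin 2) (Fin 2) ℤ).adjugate := by
      rw [Matrix.coe_units_inv, Matrix.inv_def, h1]; simp
    have hN : (N : Matrix (Fin 2) (Fin 2) ℤ) * (N : Matrix (Fin 2) (Fin 2) ℤ).adjugate = 1 := by
      rw [Matrix.mul_adjugate, h1, one_smul]
    refine ⟨?_, ?_, ?_⟩
    · rw [hinv, Matrix.det_adjugate, h1]; simp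
    · rw [hinv]
      conv_lhs => rw [← h2]
      have : (N : Matrix (Fin 2) (Fin 2) ℤ).adjugateᵀ * (N : Matrix (Fin 2) (Fin 2) ℤ)ᵀ = 1 := by
        rw [← Matrix.transpose_mul, hN, Matrix.transpose_one]
      calc _ = ((N : Matrix (Fin 2) (Fin 2) ℤ).adjugateᵀ * (N : Matrix (Fin 2) (Fin 2) ℤ)ᵀ) *
          !![2 * a, b; b, 2 * c] * ((N : Matrix (Fin 2) (Fin 2) ℤ) *
            (N : Matrix (Fin 2) (Fin 2) ℤ).adjugate) := by simp only [Matrix.mul_assoc]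
        _ = _ := by rw [this, hN, one_mul, mul_one]
    · rw [hinv, Matrix.adjugate_fin_two]
      simp
      linarith

lemma pell_parity (b d U V k : ℤ) (hd : d = b ^ 2 - 4 * k) (hUV : U ^ 2 - d * V ^ 2 = 4) :
    2 * ((U - b * V) / 2) = U - b * V ∧ 2 * ((U + b * V) / 2) = U + b * V := by
  have h : Even ((U - b * V) * (U + b * V)) := ⟨2 - 2 * k * V ^ 2, by subst hd; linarith⟩
  have h2 : (U + b * V) = (U - b * V) + 2 * (b * V) := by ring
  rcases Int.even_mul.mp h with ⟨m, hm⟩ | ⟨m, hm⟩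
  · omega
  · omega

lemma u_mem (a b c d : ℤ) (ha : a ≠ 0) (hprim : Int.gcd a (Int.gcd b c) = 1)
    (hd : d = b ^ 2 - 4 * a * c) (hdpos : 0 < d)
    (U V : ℤ) (hU : 0 < U) (hUV : U ^ 2 - d * V ^ 2 = 4)
    (u : GL (Fin 2) ℤ)
    (hu : (u : Matrix (Fin 2) (Fin 2) ℤ) =
      !![(U - b * V) / 2, -c * V; a * V, (U + b * V) / 2]) :
    u ∈ autGrp a b c d ha hprim hd hdpos := by
  obtain ⟨h1, h2⟩ := pell_parity b d U V (a * c) (by linarith) hUV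
  generalize (U - b * V) / 2 = p at *
  generalize (U + b * V) / 2 = s at *
  have hps : p + s = U := by linarith
  have hsp : s = p + b * V := by linarith
  have hU' : U = 2 * p + b * V := by linarith
  subst hU' hsp hd
  have hdet : p * (p + b * V) - -c * V * (a * V) = 1 := by
    have : 4 * (p * (p + b * V) - -c * V * (a * V)) = 4 * 1 := by linear_combination hUV
    linarith
  refine ⟨?_, ?_, ?_⟩
  · rw [hu, Matrix.det_fin_two]; simpa using hdet
  · rw [hu]
    ext i j
    fin_cases i <;> fin_cases j <;> simp [Matrix.mul_apply, Fin.sum_univ_two]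
    · linear_combination 2 * a * hdet
    · linear_combination b * hdet
    · linear_combination b * hdet
    · linear_combination 2 * c * hdet
  · rw [hu]; simp; linarith

lemma pell_step (d U V x y Y : ℤ) (hdpos : 0 < d) (hU : 0 < U) (hV : 0 < V)
    (hUV : U ^ 2 - d * V ^ 2 = 4) (h3 : 0 < x) (hpos : 0 < y) (hxy : x ^ 2 - d * y ^ 2 = 4)
    (hVy : V ≤ y) (hY : 2 * Y = y * U - x * V) : 0 ≤ Y ∧ Y < y := by
  have hx : x ^ 2 = 4 + d * y ^ 2 := by linarith
  have hx' : U ^ 2 = 4 + d * V ^ 2 := by linarith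
  have hVp : 0 < V ^ 2 := by positivity
  have hdV : 0 < d * V ^ 2 := by positivity
  constructor
  · have : x * V ≤ y * U := by
      apply (abs_le_of_sq_le_sq' _ (by positivity)).2
      have hsq : V ^ 2 ≤ y ^ 2 := pow_le_pow_left₀ hV.le hVy 2
      rw [mul_pow, mul_pow, hx, hx']
      linarith
    linarith
  · have : y * (U - 2) < x * V := by
      apply (abs_lt_of_sq_lt_sq' _ (by positivity)).2
      have h2 : 2 ≤ U := by nlinarith
      have hx2 : (U - 2) ^ 2 ≤ d * V ^ 2 := by linarith
      have := mul_le_mul_of_nonneg_left hx2 (sq_nonneg y)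
      rw [mul_pow, mul_pow, hx]
      linarith
    linarith

lemma descent (a b c d : ℤ) (ha : a ≠ 0) (hprim : Int.gcd a (Int.gcd b c) = 1)
    (hd : d = b ^ 2 - 4 * a * c) (hdpos : 0 < d)
    (U V : ℤ) (hU : 0 < U) (hV : 0 < V) (hUV : U ^ 2 - d * V ^ 2 = 4)
    (hmin : ∀ x y : ℤ, 0 < x → 0 < y → x ^ 2 - d * y ^ 2 = 4 → U ≤ x)
    (u : GL (Fin 2) ℤ)
    (hu : (u : Matrix (Fin 2) (Fin 2) ℤ) =
      !![(U - b * V) / 2, -c * V; a * V, (U + b * V) / 2]) (n : ℕ) :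
    ∀ N ∈ autGrp a b c d ha hprim hd hdpos, ∀ y : ℤ, y.toNat = n → 0 ≤ y →
      (N : Matrix (Fin 2) (Fin 2) ℤ) 1 0 = a * y → N ∈ Subgroup.zpowers u := by
  induction n using Nat.strong_induction_on with
  | _ n ih =>
  intro N hN y hyn hy0 hNy
  have humem := u_mem a b c d ha hprim hd hdpos U V hU hUV u hu
  obtain ⟨h1, h2, h3⟩ := id hN
  obtain ⟨x, y', hxy, e0, e1, e2, e3, e4⟩ := aut_param a b c ha hprim d hd _ h1 h2
  obtain rfl : y' = y := mul_left_cancel₀ ha (by rw [← e3, hNy])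
  rw [e0] at h3
  rcases hy0.eq_or_lt with h0 | hpos
  · subst h0
    have hx2 : x = 2 := by nlinarith
    subst hx2
    have : N = 1 := by
      ext i j
      fin_cases i <;> fin_cases j <;> simp
      · linarith
      · simpa using e2
      · simpa using e3
      · linarith
    rw [this]; exact one_mem _
  · have hUx := hmin x y' h3 hpos hxy
    have hVy : V ≤ y' := by
      by_contra hlt
      push Not at hlt
      have : d * y' ^ 2 < d * V ^ 2 := by
        apply mul_lt_mul_of_pos_left _ hdpos
        nlinarith
      nlinarith
    have hN' : N * u⁻¹ ∈ autGrp a b c d ha hprim hd hdpos := mul_mem hN (inv_mem humem)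
    have hinv : ((u⁻¹ : GL (Fin 2) ℤ) : Matrix (Fin 2) (Fin 2) ℤ) =
        (u : Matrix (Fin 2) (Fin 2) ℤ).adjugate := by
      rw [Matrix.coe_units_inv, Matrix.inv_def, humem.1]; simp
    obtain ⟨k1, k2, k3⟩ := id hN'
    obtain ⟨X, Y, hXY, E0, E1, E2, E3, E4⟩ := aut_param a b c ha hprim d hd _ k1 k2
    obtain ⟨w1, w2⟩ := pell_parity b d U V (a * c) (by linarith) hUV
    have hE := E3
    rw [Units.val_mul, hinv, hu, Matrix.adjugate_fin_two, Matrix.mul_apply, Fin.sum_univ_two] at hE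
    simp at hE
    have hY : 2 * Y = y' * U - x * V := by
      apply mul_left_cancel₀ ha
      rw [e3] at hE
      linear_combination (-2) * hE + a * y' * w2 - a * V * e4
    obtain ⟨hYn, hYl⟩ := pell_step d U V x y' Y hdpos hU hV hUV h3 hpos hxy hVy hY
    have := ih Y.toNat (by omega) _ hN' Y rfl hYn E3
    simpa using mul_mem this (Subgroup.mem_zpowers u)

lemma cone_comp {E : Type*} [AddCommGroup E] [Module ℝ E] [TopologicalSpace E]
    [IsTopologicalAddGroup E] [ContinuousSMul ℝ E] (f g : E →L[ℝ] ℝ)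
    (v : E) (hf : 0 < f v) (hg : 0 < g v) :
    connectedComponentIn {w | 0 < f w * g w} v = {w | 0 < f w ∧ 0 < g w} := by
  apply subset_antisymm
  · intro w hw
    have hwl : 0 < f w * g w := by
      have := connectedComponentIn_subset _ _ hw
      simpa only [Set.mem_ofPred_eq] using this
    have hfw : 0 < f w := by
      by_contra hn
      have hpre : IsPreconnected (connectedComponentIn {w | 0 < f w * g w} v) :=
        isPreconnected_connectedComponentIn
      have hv : v ∈ connectedComponentIn {w | 0 < f w * g w} v :=
        mem_connectedComponentIn (mul_pos hf hg)
      have := hpre.intermediate_value hw hv f.continuous.continuousOn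
      obtain ⟨z, hz, hz0⟩ := this ⟨not_lt.mp hn, hf.le⟩
      have hz2 : 0 < f z * g z := by
        have := connectedComponentIn_subset _ _ hz
        simpa only [Set.mem_ofPred_eq] using this
      rw [hz0] at hz2
      simp at hz2
    exact ⟨hfw, (pos_iff_pos_of_mul_pos hwl).mp hfw⟩
  · apply IsPreconnected.subset_connectedComponentIn
    · apply Convex.isPreconnected
      exact (convex_halfSpace_gt f.isLinear 0).inter (convex_halfSpace_gt g.isLinear 0)
    · exact ⟨hf, hg⟩
    · rintro w ⟨h1, h2⟩
      exact mul_pos h1 h2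

lemma cone_main (a b c d x y p q r s : ℤ) (ha : a ≠ 0)
    (hd : d = b ^ 2 - 4 * a * c) (hdpos : 0 < d) (hxy : x ^ 2 - d * y ^ 2 = 4)
    (hdet : p * s - q * r = 1)
    (e1 : 2 * p = x - b * y) (e2 : q = -c * y) (e3 : r = a * y) (e4 : 2 * s = x + b * y)
    (C : Set (Fin 2 → ℝ)) (F : (Fin 2 → ℝ) → (Fin 2 → ℝ))
    (hF : ∀ v, F v = ![p * v 0 + q * v 1, r * v 0 + s * v 1])
    (hC : ∃ v ∈ {v : Fin 2 → ℝ | 0 < 2 * (a * v 0 ^ 2 + b * v 0 * v 1 + c * v 1 ^ 2)},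
      C = connectedComponentIn
        {v : Fin 2 → ℝ | 0 < 2 * (a * v 0 ^ 2 + b * v 0 * v 1 + c * v 1 ^ 2)} v) :
    F '' C = C ↔ 0 < x := by
  obtain ⟨δ, hδ0, hδ⟩ : ∃ δ : ℝ, 0 < δ ∧ δ ^ 2 = d :=
    ⟨√d, Real.sqrt_pos.mpr (by exact_mod_cast hdpos), Real.sq_sqrt (by exact_mod_cast hdpos.le)⟩
  have hdR : (d : ℝ) = b ^ 2 - 4 * a * c := by exact_mod_cast hd
  have haR : (a : ℝ) ≠ 0 := by exact_mod_cast ha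
  have hxyR : (x : ℝ) ^ 2 - d * y ^ 2 = 4 := by exact_mod_cast hxy
  have e1R : 2 * (p : ℝ) = x - b * y := by exact_mod_cast e1
  have e2R : (q : ℝ) = -c * y := by exact_mod_cast e2
  have e3R : (r : ℝ) = a * y := by exact_mod_cast e3
  have e4R : 2 * (s : ℝ) = x + b * y := by exact_mod_cast e4
  have hdetR : (p : ℝ) * s - q * r = 1 := by exact_mod_cast hdet
  -- linear forms
  let P : Fin 2 → ((Fin 2 → ℝ) →L[ℝ] ℝ) := fun i => ContinuousLinearMap.proj i
  have hP : ∀ i v, P i v = v i := fun i v => rfl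
  obtain ⟨f, g, hf, hg⟩ : ∃ f g : (Fin 2 → ℝ) →L[ℝ] ℝ,
      (∀ v, f v = 2 * a * v 0 + (b - δ) * v 1) ∧
      (∀ v, g v = a * (2 * a * v 0 + (b + δ) * v 1)) := by
    refine ⟨(2 * a : ℝ) • P 0 + (b - δ : ℝ) • P 1,
      (a : ℝ) • ((2 * a : ℝ) • P 0 + (b + δ : ℝ) • P 1), ?_, ?_⟩ <;> intro v <;> simp [hP] <;> ring
  have hlc : {v : Fin 2 → ℝ | 0 < 2 * (a * v 0 ^ 2 + b * v 0 * v 1 + c * v 1 ^ 2)} =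
      {v | 0 < f v * g v} := by
    ext v
    have : f v * g v = (2 * (a:ℝ) ^ 2) *
        (2 * (a * v 0 ^ 2 + b * v 0 * v 1 + c * v 1 ^ 2)) := by
      rw [hf, hg]
      linear_combination (-a * v 1 ^ 2 : ℝ) * hδ - (a * v 1 ^ 2 : ℝ) * hdR
    simp only [Set.mem_ofPred_eq]
    rw [this]
    exact (mul_pos_iff_of_pos_left (by positivity)).symm
  obtain ⟨f, g, κ, hκ, hfF, hgF, hfC⟩ : ∃ f g : (Fin 2 → ℝ) →L[ℝ] ℝ, ∃ κ : ℝ, κ ^ 2 = d ∧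
      (∀ v, 2 * f (F v) = (x - κ * y) * f v) ∧ (∀ v, 2 * g (F v) = (x + κ * y) * g v) ∧
      C = {w | 0 < f w ∧ 0 < g w} ∧ C.Nonempty := by
    rw [hlc] at hC
    obtain ⟨v, hv, hCv⟩ := hC
    have hFf : ∀ v, 2 * f (F v) = (x - δ * y) * f v := by
      intro v
      rw [hf, hf, hF]
      simp only [Matrix.cons_val_zero, Matrix.cons_val_one]
      rw [e2R, e3R]
      linear_combination (2 * a * v 0 : ℝ) * e1R + ((b - δ) * v 1 : ℝ) * e4R
        - (v 1 * y : ℝ) * hδ - (v 1 * y : ℝ) * hdR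
    have hFg : ∀ v, 2 * g (F v) = (x + δ * y) * g v := by
      intro v
      rw [hg, hg, hF]
      simp only [Matrix.cons_val_zero, Matrix.cons_val_one]
      rw [e2R, e3R]
      linear_combination (a : ℝ) * ((2 * a * v 0 : ℝ) * e1R + ((b + δ) * v 1 : ℝ) * e4R
        - (v 1 * y : ℝ) * hδ - (v 1 * y : ℝ) * hdR)
    have hne : C.Nonempty := ⟨v, hCv ▸ mem_connectedComponentIn hv⟩
    have hv' : 0 < f v * g v := hv
    rcases pos_and_pos_or_neg_and_neg_of_mul_pos hv' with ⟨h1, h2⟩ | ⟨h1, h2⟩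
    · exact ⟨f, g, δ, hδ, hFf, hFg, by rw [hCv, cone_comp f g v h1 h2], hne⟩
    · refine ⟨-f, -g, δ, hδ, ?_, ?_, ?_, hne⟩
      · intro v; have := hFf v; simp; linarith
      · intro v; have := hFg v; simp; linarith
      · rw [hCv, ← cone_comp (-f) (-g) v (by simpa using h1) (by simpa using h2)]
        simp
  obtain ⟨hCe, hne⟩ := hfC
  have hprod : ((x : ℝ) - κ * y) * (x + κ * y) = 4 := by
    linear_combination hxyR - (y ^ 2 : ℝ) * hκ
  constructor
  · intro h
    obtain ⟨w, hw⟩ := hne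
    have hFw : F w ∈ C := h ▸ Set.mem_image_of_mem F hw
    rw [hCe] at hw hFw
    have h1 : 0 < (x : ℝ) - κ * y := by
      have := hfF w
      exact pos_of_mul_pos_left (by linarith [hFw.1]) hw.1.le
    have h2 : 0 < (x : ℝ) + κ * y := by
      have := hgF w
      exact pos_of_mul_pos_left (by linarith [hFw.2]) hw.2.le
    have : (0 : ℝ) < x := by linarith
    exact_mod_cast this
  · intro hx
    have hxR : (0 : ℝ) < x := by exact_mod_cast hx
    have hs : 0 < (x : ℝ) - κ * y ∧ 0 < (x : ℝ) + κ * y := by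
      rcases pos_and_pos_or_neg_and_neg_of_mul_pos (by rw [hprod]; norm_num :
        0 < ((x : ℝ) - κ * y) * (x + κ * y)) with h | h
      · exact h
      · linarith [h.1, h.2]
    have hmem : ∀ v, F v ∈ C ↔ v ∈ C := by
      intro v
      rw [hCe]
      simp only [Set.mem_ofPred_eq]
      have h1 := hfF v
      have h2 := hgF v
      rw [← mul_pos_iff_of_pos_left (two_pos : (0:ℝ) < 2) (b := f (F v)), h1,
        ← mul_pos_iff_of_pos_left (two_pos : (0:ℝ) < 2) (b := g (F v)), h2,
        mul_pos_iff_of_pos_left hs.1, mul_pos_iff_of_pos_left hs.2]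
    apply subset_antisymm
    · rintro _ ⟨v, hv, rfl⟩
      exact (hmem v).mpr hv
    · intro w hw
      have hFw : F ![s * w 0 - q * w 1, -r * w 0 + p * w 1] = w := by
        rw [hF]
        ext i
        fin_cases i
        · simp
          linear_combination (w 0) * hdetR
        · simp
          linear_combination (w 1) * hdetR
      exact ⟨_, (hmem _).mp (by rw [hFw]; exact hw), hFw⟩

/-- a proper automorph preserves a connected component of the light
cone if and only if it is a power `u^k` of the fundamental automorph. -/
theorem orthochronous_proper_automorphs
    (a b c : ℤ) (ha : a ≠ 0) (hprim : Int.gcd a (Int.gcd b c) = 1)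
    (d : ℤ) (hd : d = b ^ 2 - 4 * a * c) (hdpos : 0 < d)
    (hdsq : ¬ ∃ m : ℤ, m * m = d)
    (U V : ℤ) (hU : 0 < U) (hV : 0 < V) (hUV : U ^ 2 - d * V ^ 2 = 4)
    (hmin : ∀ x y : ℤ, 0 < x → 0 < y → x ^ 2 - d * y ^ 2 = 4 → U ≤ x)
    (G : Matrix (Fin 2) (Fin 2) ℤ) (hG : G = !![2 * a, b; b, 2 * c])
    (u : Matrix.GeneralLinearGroup (Fin 2) ℤ)
    (hu : (u : Matrix (Fin 2) (Fin 2) ℤ) =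
      !![(U - b * V) / 2, -c * V; a * V, (U + b * V) / 2])
    (lightCone : Set (Fin 2 → ℝ))
    (hlc : lightCone = {v : Fin 2 → ℝ | 0 < v ⬝ᵥ ((G.map (Int.cast : ℤ → ℝ)).mulVec v)})
    (C : Set (Fin 2 → ℝ))
    (hC : ∃ v ∈ lightCone, C = connectedComponentIn lightCone v)
    (M : Matrix (Fin 2) (Fin 2) ℤ) (hdet : M.det = 1) (hM : Mᵀ * G * M = G) :
    (M.map (Int.cast : ℤ → ℝ)).mulVec '' C = C ↔
      ∃ k : ℤ, M = ((u ^ k : Matrix.GeneralLinearGroup (Fin 2) ℤ) :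
        Matrix (Fin 2) (Fin 2) ℤ) := by
  have hM' := hM
  rw [hG] at hM'
  obtain ⟨x, y, hxy, e0, e1, e2, e3, e4⟩ := aut_param a b c ha hprim d hd M hdet hM'
  have hset : lightCone =
      {v : Fin 2 → ℝ | 0 < 2 * (a * v 0 ^ 2 + b * v 0 * v 1 + c * v 1 ^ 2)} := by
    rw [hlc, hG]
    ext v
    simp only [Set.mem_ofPred_eq]
    have : v ⬝ᵥ ((!![2 * a, b; b, 2 * c].map (Int.cast : ℤ → ℝ)).mulVec v) =
        2 * (a * v 0 ^ 2 + b * v 0 * v 1 + c * v 1 ^ 2) := by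
      simp [dotProduct, Matrix.mulVec, Fin.sum_univ_two]
      ring
    rw [this]
  rw [hset] at hC
  have hdet2 := hdet
  rw [Matrix.det_fin_two] at hdet2
  rw [cone_main a b c d x y (M 0 0) (M 0 1) (M 1 0) (M 1 1) ha hd hdpos hxy hdet2 e1 e2 e3 e4 C _
    (fun v => by
      ext i
      fin_cases i <;> simp [dotProduct, Matrix.mulVec, Fin.sum_univ_two]) hC]
  have humem := u_mem a b c d ha hprim hd hdpos U V hU hUV u hu
  constructor
  · intro hx
    let N : GL (Fin 2) ℤ := Matrix.GeneralLinearGroup.mk'' M (by rw [hdet]; exact isUnit_one)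
    have hNM : (N : Matrix (Fin 2) (Fin 2) ℤ) = M := rfl
    have hN : N ∈ autGrp a b c d ha hprim hd hdpos := ⟨hdet, hM', by rw [hNM, e0]; exact hx⟩
    have hz : N ∈ Subgroup.zpowers u := by
      rcases le_total 0 y with hy | hy
      · exact descent a b c d ha hprim hd hdpos U V hU hV hUV hmin u hu _ N hN y rfl hy e3
      · rw [← inv_mem_iff]
        refine descent a b c d ha hprim hd hdpos U V hU hV hUV hmin u hu _ N⁻¹ (inv_mem hN) (-y)
          rfl (by linarith) ?_
        rw [Matrix.coe_units_inv, Matrix.inv_def, hNM, hdet, Matrix.adjugate_fin_two]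
        simp [e3]
    obtain ⟨k, hk⟩ := hz
    exact ⟨k, by rw [← hNM, ← hk]⟩
  · rintro ⟨k, hk⟩
    have := (zpow_mem humem k).2.2
    rw [← hk, e0] at this
    exact this
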